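/- Let α > -1/2 and let φ : [0,∞) → (0,∞) be continuous and monotonic with φ(r) → ∞ as r → ∞. Then sup_{r>0} ( r^{n+α+1} / (φ(r) · e^r · d_n(α)) ) → 0 as n → ∞; that is, the sequence of monomials z ↦ z^n / d_n(α) converges to 0 in the norm ‖f‖ = sup_{r>0} M_∞(f,r) · r^{α+1} / (φ(r) e^r). -/

import Mathlib

open Filter

/-- `d_n(α) = 2^n ⌊n/2⌋! Γ(⌊(n+1)/2⌋ + α + 1) / Γ(α+1)`. -/
noncomputable def dunklD (α : ℝ) (n : ℕ) : ℝ :=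
  2 ^ n * (Nat.factorial (n / 2)) *
    Real.Gamma ((((n + 1) / 2 : ℕ) : ℝ) + α + 1) / Real.Gamma (α + 1)

/-- The elementary inequality `(1 + u) log (1 + u) - (1 - u) log (1 - u) ≤ 2u` on `[0, 1)`. -/
lemma one_add_mul_log_sub_le {u : ℝ} (hu0 : 0 ≤ u) (hu1 : u < 1) :
    (1 + u) * Real.log (1 + u) - (1 - u) * Real.log (1 - u) ≤ 2 * u := by
  have hd : ∀ x ∈ Set.Ico (0 : ℝ) 1, HasDerivAt
      (fun x : ℝ => 2 * x - ((1 + x) * Real.log (1 + x) - (1 - x) * Real.log (1 - x)))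
      (-(Real.log (1 + x) + Real.log (1 - x))) x := by
    rintro x ⟨hx0, hx1⟩
    have ha : HasDerivAt (fun x : ℝ => 1 + x) 1 x := (hasDerivAt_id x).const_add 1
    have hb : HasDerivAt (fun x : ℝ => 1 - x) (-1) x := (hasDerivAt_id x).const_sub 1
    have hp : (1 + x) ≠ 0 := by linarith
    have hm : (1 - x) ≠ 0 := by linarith
    have h := ((hasDerivAt_id x).const_mul 2).sub
      ((ha.mul (ha.log hp)).sub (hb.mul (hb.log hm)))
    refine h.congr_deriv ?_
    rw [mul_div_cancel₀ _ hp, mul_div_cancel₀ _ hm]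
    ring
  have hmono : MonotoneOn
      (fun x : ℝ => 2 * x - ((1 + x) * Real.log (1 + x) - (1 - x) * Real.log (1 - x)))
      (Set.Ico (0 : ℝ) 1) := by
    refine monotoneOn_of_deriv_nonneg (convex_Ico 0 1)
      (fun x hx => (hd x hx).continuousAt.continuousWithinAt)
      (fun x hx => (hd x (interior_subset hx)).differentiableAt.differentiableWithinAt) ?_
    intro x hx
    obtain ⟨hx0, hx1⟩ := interior_subset hx
    rw [(hd x ⟨hx0, hx1⟩).deriv, ← Real.log_mul (by linarith) (by linarith)]
    have := Real.log_nonpos (x := (1 + x) * (1 - x)) (by nlinarith) (by nlinarith)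
    linarith
  have h := hmono ⟨le_rfl, one_pos⟩ ⟨hu0, hu1⟩ hu0
  simp at h
  linarith

lemma add_one_mul_log_add_one_le {s : ℝ} (hs : 0 < s) :
    (s + 1) * Real.log (s + 1) ≤ Real.log (s + 1 / 2) + 1 + s * Real.log s := by
  have h := one_add_mul_log_sub_le (u := 1 / (2 * s + 1)) (by positivity)
    (by rw [div_lt_one (by positivity)]; linarith)
  have e1 : 1 + 1 / (2 * s + 1) = (s + 1) / (s + 1 / 2) := by field_simp; ring
  have e2 : 1 - 1 / (2 * s + 1) = s / (s + 1 / 2) := by field_simp; ring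
  rw [e1, e2, Real.log_div (by positivity) (by positivity),
    Real.log_div (by positivity) (by positivity)] at h
  have e3 : 2 * (1 / (2 * s + 1)) = 1 / (s + 1 / 2) := by field_simp
  rw [e3] at h
  have h2 := mul_le_mul_of_nonneg_right h (show 0 ≤ s + 1 / 2 by positivity)
  have e4 : 1 / (s + 1 / 2) * (s + 1 / 2) = 1 := by field_simp
  have e5 : ∀ a b : ℝ, ((s + 1) / (s + 1 / 2) * a - s / (s + 1 / 2) * b) * (s + 1 / 2) =
      (s + 1) * a - s * b := by intro a b; field_simp
  rw [e4, e5] at h2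
  linarith

/-- The logarithm of `Γ(s + 1/2) / (s / e) ^ s`. -/
noncomputable def logGammaStirlingRatio (s : ℝ) : ℝ :=
  Real.log (Real.Gamma (s + 1 / 2)) - s * Real.log s + s

lemma logGammaStirlingRatio_le_add_one {s : ℝ} (hs : 0 < s) :
    logGammaStirlingRatio s ≤ logGammaStirlingRatio (s + 1) := by
  unfold logGammaStirlingRatio
  have hpos : 0 < s + 1 / 2 := by positivity
  rw [show s + 1 + 1 / 2 = (s + 1 / 2) + 1 by ring, Real.Gamma_add_one hpos.ne',
    Real.log_mul hpos.ne' (Real.Gamma_pos_of_pos hpos).ne']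
  linarith [add_one_mul_log_add_one_le hs]

lemma exists_le_logGammaStirlingRatio {a : ℝ} (ha : 0 < a) :
    ∃ B : ℝ, ∀ n : ℕ, B ≤ logGammaStirlingRatio ((n + a) / 2) := by
  refine ⟨min (logGammaStirlingRatio (a / 2)) (logGammaStirlingRatio ((1 + a) / 2)), fun n => ?_⟩
  induction n using Nat.twoStepInduction with
  | zero => simp
  | one => simp
  | more n ih _ =>
    refine ih.trans ((logGammaStirlingRatio_le_add_one (by positivity)).trans_eq ?_)
    congr 1
    push_cast
    ring

lemma dunklD_pos {α : ℝ} (hα : -1 / 2 < α) (n : ℕ) : 0 < dunklD α n := by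
  have h1 : 0 < Real.Gamma ((((n + 1) / 2 : ℕ) : ℝ) + α + 1) :=
    Real.Gamma_pos_of_pos (by
      have : (0 : ℝ) ≤ (((n + 1) / 2 : ℕ) : ℝ) := Nat.cast_nonneg _
      linarith)
  have h2 : 0 < Real.Gamma (α + 1) := Real.Gamma_pos_of_pos (by linarith)
  unfold dunklD
  positivity

/-- Log-convexity of `Γ` bounds `dunklD` below by a square of a single Gamma value. -/
lemma le_log_dunklD {α : ℝ} (hα : -1 / 2 < α) (n : ℕ) :
    n * Real.log 2 + 2 * Real.log (Real.Gamma ((n + (α + 1)) / 2 + 1 / 2))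
      - Real.log (Real.Gamma (α + 1)) ≤ Real.log (dunklD α n) := by
  have hm0 : (0 : ℝ) ≤ (((n + 1) / 2 : ℕ) : ℝ) := Nat.cast_nonneg _
  have hm : 0 < (((n + 1) / 2 : ℕ) : ℝ) + α + 1 := by linarith
  have hk : (0 : ℝ) < ((n / 2 : ℕ) : ℝ) + 1 := by positivity
  have h1 := Real.Gamma_pos_of_pos hm
  have h2 : 0 < Real.Gamma (α + 1) := Real.Gamma_pos_of_pos (by linarith)
  have hsum : (((n + 1) / 2 : ℕ) : ℝ) + ((n / 2 : ℕ) : ℝ) = n := by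
    rw [← Nat.cast_add]
    congr 1
    omega
  have hconv := Real.convexOn_log_Gamma.2 (Set.mem_Ioi.2 hk) (Set.mem_Ioi.2 hm)
    (show (0 : ℝ) ≤ 1 / 2 by norm_num) (show (0 : ℝ) ≤ 1 / 2 by norm_num) (by norm_num)
  have hmid : (1 / 2 : ℝ) • (((n / 2 : ℕ) : ℝ) + 1) +
      (1 / 2 : ℝ) • ((((n + 1) / 2 : ℕ) : ℝ) + α + 1) = (n + (α + 1)) / 2 + 1 / 2 := by
    simp only [smul_eq_mul]
    linarith
  rw [hmid] at hconv
  simp only [Function.comp_apply, smul_eq_mul] at hconv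
  unfold dunklD
  have hfac : (0 : ℝ) < (Nat.factorial (n / 2) : ℝ) := by positivity
  rw [Real.log_div (by positivity) h2.ne', Real.log_mul (by positivity) h1.ne',
    Real.log_mul (by positivity) hfac.ne', Real.log_pow, ← Real.Gamma_nat_eq_factorial]
  linarith

lemma mul_log_sub_le {x r : ℝ} (hx : 0 < x) (hr : 0 < r) :
    x * Real.log r - r ≤ x * Real.log x - x := by
  have h := mul_le_mul_of_nonneg_left (Real.log_le_sub_one_of_pos (div_pos hr hx)) hx.le
  rw [Real.log_div hr.ne' hx.ne', mul_sub, mul_sub, mul_div_cancel₀ _ hx.ne'] at h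
  linarith

/-- The monomials `z ^ n / dunklD α n` are uniformly bounded by a multiple of `e ^ r / r ^ (α + 1)`. -/
lemma exists_rpow_le_exp_mul_dunklD {α : ℝ} (hα : -1 / 2 < α) :
    ∃ C : ℝ, 0 < C ∧ ∀ (n : ℕ) (r : ℝ), 0 < r →
      r ^ ((n : ℝ) + α + 1) ≤ C * (Real.exp r * dunklD α n) := by
  have ha : 0 < α + 1 := by linarith
  obtain ⟨B, hB⟩ := exists_le_logGammaStirlingRatio ha
  refine ⟨Real.exp ((α + 1) * Real.log 2 - 2 * B + Real.log (Real.Gamma (α + 1))),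
    Real.exp_pos _, fun n r hr => ?_⟩
  have hd := dunklD_pos hα n
  have hx : 0 < (n : ℝ) + (α + 1) := by positivity
  have hBn := hB n
  unfold logGammaStirlingRatio at hBn
  rw [Real.log_div hx.ne' two_ne_zero] at hBn
  have h1 := mul_log_sub_le hx hr
  have h2 := le_log_dunklD hα n
  rw [add_assoc, Real.rpow_def_of_pos hr]
  rw [← Real.exp_log hd]
  rw [← Real.exp_add, ← Real.exp_add, Real.exp_le_exp]
  linarith

/-- For `φ : [0,∞) → (0,∞)` continuous and monotonic with `φ(r) → ∞`,
`sup_{r>0} r^(n+α+1)/(φ(r) e^r d_n(α)) → 0` as `n → ∞`; i.e. the monomials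
`z^n/d_n(α)` tend to `0` in the norm `‖f‖ = sup_{r>0} M_∞(f,r) r^(α+1)/(φ(r)e^r)`
(note `M_∞(z^n/d_n(α), r) = r^n/d_n(α)`). -/
theorem monomials_tendsto_zero (α : ℝ) (hα : -1/2 < α) (φ : ℝ → ℝ)
    (hφpos : ∀ r ≥ (0 : ℝ), 0 < φ r) (hφcont : ContinuousOn φ (Set.Ici 0))
    (hφmono : MonotoneOn φ (Set.Ici 0)) (hφ : Tendsto φ atTop atTop) :
    Tendsto
      (fun n : ℕ => ⨆ r : Set.Ioi (0 : ℝ),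
        (r : ℝ) ^ ((n : ℝ) + α + 1) / (φ r * Real.exp r * dunklD α n))
      atTop (nhds 0) := by
  obtain ⟨C, hC, hbound⟩ := exists_rpow_le_exp_mul_dunklD hα
  have hφ0 : 0 < φ 0 := hφpos 0 le_rfl
  rw [Metric.tendsto_atTop']
  intro ε hε
  obtain ⟨R, hRpos, hR⟩ : ∃ R : ℝ, 0 < R ∧ ∀ r ≥ R, C / (ε / 2) ≤ φ r := by
    obtain ⟨R, hR⟩ := eventually_atTop.1 (hφ.eventually_ge_atTop (C / (ε / 2)))
    exact ⟨max R 1, by positivity, fun r hr => hR r ((le_max_left _ _).trans hr)⟩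
  have hlim : Tendsto (fun n : ℕ => C * Real.exp (2 * R) / φ 0 * (1 / 2 : ℝ) ^ n) atTop (nhds 0) := by
    simpa using (tendsto_pow_atTop_nhds_zero_of_lt_one (r := (1 / 2 : ℝ)) (by norm_num)
      (by norm_num)).const_mul (C * Real.exp (2 * R) / φ 0)
  obtain ⟨N, hN⟩ := eventually_atTop.1 (hlim.eventually_le_const (half_pos hε))
  refine ⟨N, fun n hn => ?_⟩
  have hd := dunklD_pos hα n
  have hnonneg : 0 ≤ ⨆ r : Set.Ioi (0 : ℝ),
      (r : ℝ) ^ ((n : ℝ) + α + 1) / (φ r * Real.exp r * dunklD α n) := by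
    refine Real.iSup_nonneg fun ⟨r, hr⟩ => ?_
    have hr : 0 < r := hr
    have := hφpos r hr.le
    positivity
  rw [Real.dist_eq, sub_zero, abs_of_nonneg hnonneg]
  refine (Real.iSup_le (fun ⟨r, hr⟩ => ?_) (half_pos hε).le).trans_lt (half_lt_self hε)
  have hr : 0 < r := hr
  have hφr := hφpos r hr.le
  change r ^ ((n : ℝ) + α + 1) / (φ r * Real.exp r * dunklD α n) ≤ ε / 2
  rw [div_le_iff₀ (by positivity)]
  rcases le_total R r with hRr | hRr
  · have h1 : C ≤ φ r * (ε / 2) := (div_le_iff₀ (half_pos hε)).1 (hR r hRr)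
    calc r ^ ((n : ℝ) + α + 1) ≤ C * (Real.exp r * dunklD α n) := hbound n r hr
      _ ≤ φ r * (ε / 2) * (Real.exp r * dunklD α n) := by gcongr
      _ = ε / 2 * (φ r * Real.exp r * dunklD α n) := by ring
  · have hx : 0 ≤ (n : ℝ) + α + 1 := by
      have : (0 : ℝ) ≤ n := n.cast_nonneg
      linarith
    have h1 : (2 * R) ^ ((n : ℝ) + α + 1) ≤ C * (Real.exp (2 * R) * dunklD α n) :=
      hbound n (2 * R) (by positivity)
    have h2 : (2 : ℝ) ^ n * R ^ ((n : ℝ) + α + 1) ≤ (2 * R) ^ ((n : ℝ) + α + 1) := by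
      rw [Real.mul_rpow zero_le_two hRpos.le, ← Real.rpow_natCast]
      gcongr
      · norm_num
      · linarith
    have h3 : φ 0 ≤ φ r := hφmono Set.self_mem_Ici hr.le hr.le
    have h4 : 1 ≤ Real.exp r := Real.one_le_exp hr.le
    have h5 : (1 / 2 : ℝ) ^ n * 2 ^ n = 1 := by rw [← mul_pow]; norm_num
    calc r ^ ((n : ℝ) + α + 1) ≤ R ^ ((n : ℝ) + α + 1) := Real.rpow_le_rpow hr.le hRr hx
      _ = (1 / 2 : ℝ) ^ n * (2 ^ n * R ^ ((n : ℝ) + α + 1)) := by rw [← mul_assoc, h5, one_mul]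
      _ ≤ (1 / 2 : ℝ) ^ n * (C * (Real.exp (2 * R) * dunklD α n)) := by
        exact mul_le_mul_of_nonneg_left (h2.trans h1) (by positivity)
      _ = C * Real.exp (2 * R) / φ 0 * (1 / 2 : ℝ) ^ n * (φ 0 * 1 * dunklD α n) := by
        field_simp
      _ ≤ ε / 2 * (φ r * Real.exp r * dunklD α n) := by
        gcongr
        exact hN n hn.le
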